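/- Let R be a commutative k-algebra, B = R_p(t,sigma,H,J) a BR algebra of rank n, and O a torsion-free orbit in Maxspec(R) under the Z^n-action. For each i in [n], let beta_i be the set of i-breaks in O, beta-bar_i = beta_i / Gamma_i, and beta-bar'_i the extended set of breaks. Then the isomorphism classes of simple weight B-modules supported on O are in bijection with the set (product over i = 1 to n of beta-bar'_i); moreover, a simple weight module M supported on O corresponds to the unique n-tuple ([n_1],...,[n_n]) in this product such that supp(M) = {m in O : [n_i]^- <_i m <=_i [n_i] for all i = 1,...,n}. -/

import Mathlib

open scoped Pointwise TensorProduct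

namespace BR

/-- The ordered product `t₁^{α₁} ⋯ tₙ^{αₙ}` in the group of units. -/
def tpow {A : Type*} [Monoid A] {n : ℕ} (t : Fin n → Aˣ) (α : Fin n → ℤ) : Aˣ :=
  ((List.finRange n).map fun i => t i ^ α i).prod

/-- `σ^α = σ₁^{α₁} ⋯ σₙ^{αₙ}` as an algebra automorphism. -/
def σpow {k R : Type*} [CommSemiring k] [Semiring R] [Algebra k R] {n : ℕ}
    (σ : Fin n → R ≃ₐ[k] R) (α : Fin n → ℤ) : R ≃ₐ[k] R :=
  ((List.finRange n).map fun i => σ i ^ α i).prod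

/-- The ideal `I_σ^{(m)}(H, J)`:  `J σ(J) ⋯ σ^{m-1}(J)` for `m > 0`, `R` for `m = 0`,
and `σ⁻¹(H) σ⁻²(H) ⋯ σ^{m}(H)` for `m < 0`. -/
noncomputable def seg {k R : Type*} [Field k] [Ring R] [Algebra k R]
    (σ : R ≃ₐ[k] R) (H J : Submodule k R) (m : ℤ) : Submodule k R :=
  if 0 < m then
    ((List.range m.toNat).map fun i => J.map (σ ^ (i : ℤ)).toLinearMap).prod
  else if m = 0 then ⊤
  else ((List.range (-m).toNat).map fun i => H.map (σ ^ (-((i : ℤ) + 1))).toLinearMap).prod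

/-- `I^{(α)} = I₁^{(α₁)} ⋯ Iₙ^{(αₙ)}`. -/
noncomputable def segVec {k R : Type*} [Field k] [Ring R] [Algebra k R] {n : ℕ}
    (σ : Fin n → R ≃ₐ[k] R) (H J : Fin n → Submodule k R) (α : Fin n → ℤ) :
    Submodule k R :=
  ((List.finRange n).map fun i => seg (σ i) (H i) (J i) (α i)).prod

/-- A Bell–Rogalski datum `(R, t, σ, p, H, J)`. -/
structure IsBRDatum {k R : Type*} [Field k] [Ring R] [Algebra k R] {n : ℕ}
    (σ : Fin n → R ≃ₐ[k] R) (p : Fin n → Fin n → kˣ)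
    (H J : Fin n → Submodule k R) : Prop where
  comm : ∀ i j, σ i * σ j = σ j * σ i
  antisym : ∀ i j, p i j = (p j i)⁻¹
  H_mul_left : ∀ i (r x : R), x ∈ H i → r * x ∈ H i
  H_mul_right : ∀ i (r x : R), x ∈ H i → x * r ∈ H i
  J_mul_left : ∀ i (r x : R), x ∈ J i → r * x ∈ J i
  J_mul_right : ∀ i (r x : R), x ∈ J i → x * r ∈ J i
  mapH : ∀ i j, i ≠ j → (H j).map (σ i).toLinearMap = H j
  mapJ : ∀ i j, i ≠ j → (J j).map (σ i).toLinearMap = J j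
  HH : ∀ i j, i ≠ j → H i * H j = H j * H i
  HJ : ∀ i j, i ≠ j → H i * J j = J j * H i
  JJ : ∀ i j, i ≠ j → J i * J j = J j * J i
  seg_ne_bot : ∀ i (m : ℤ), seg (σ i) (H i) (J i) m ≠ ⊥

/-- A realization of the iterated skew Laurent extension `R_p[t^{±1}; σ]`:
an algebra `A` containing `R`, with units `t i` satisfying the skew commutation
relations, which is a free left `R`-module with basis the monomials `t^α`. -/
structure SkewLaurent (k : Type*) [Field k] {R : Type*} [Ring R] [Algebra k R] {n : ℕ}
    (σ : Fin n → R ≃ₐ[k] R) (p : Fin n → Fin n → kˣ)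
    (A : Type*) [Ring A] [Algebra k A] where
  ι : R →ₐ[k] A
  t : Fin n → Aˣ
  rel_r : ∀ i (r : R), (t i : A) * ι r = ι (σ i r) * (t i : A)
  rel_t : ∀ i j, i ≠ j → (t j : A) * (t i : A) =
    algebraMap k A (p i j) * ((t i : A) * (t j : A))
  repr_exists : ∀ a : A, ∃ c : (Fin n → ℤ) →₀ R,
    a = c.sum fun α r => ι r * (tpow t α : A)
  repr_free : ∀ c : (Fin n → ℤ) →₀ R,
    (c.sum fun α r => ι r * (tpow t α : A)) = 0 → c = 0

/-- The graded component `B_α = I^{(α)} t^α` of the Bell–Rogalski algebra, as a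
`k`-subspace of the ambient skew Laurent extension. -/
noncomputable def brComponent {k R : Type*} [Field k] [Ring R] [Algebra k R] {n : ℕ}
    {σ : Fin n → R ≃ₐ[k] R} {p : Fin n → Fin n → kˣ}
    {A : Type*} [Ring A] [Algebra k A]
    (E : SkewLaurent k σ p A) (H J : Fin n → Submodule k R) (α : Fin n → ℤ) :
    Submodule k A :=
  ((segVec σ H J α).map E.ι.toLinearMap).map (LinearMap.mulRight k ((tpow E.t α : Aˣ) : A))

/-- The Bell–Rogalski algebra `B = ⊕_α I^{(α)} t^α` as a `k`-subspace of the
ambient skew Laurent extension. -/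
noncomputable def brSubmodule {k R : Type*} [Field k] [Ring R] [Algebra k R] {n : ℕ}
    {σ : Fin n → R ≃ₐ[k] R} {p : Fin n → Fin n → kˣ}
    {A : Type*} [Ring A] [Algebra k A]
    (E : SkewLaurent k σ p A) (H J : Fin n → Submodule k R) : Submodule k A :=
  ⨆ α : Fin n → ℤ, brComponent E H J α

/-- The weight space `M_𝔪 = {v ∈ M ∣ 𝔪 ⬝ v = 0}` of a module over an algebra `B`
receiving a map from `R`. -/
def weightSpace {k R B : Type*} [Field k] [CommRing R] [Algebra k R]
    [Ring B] [Algebra k B] (ιB : R →ₐ[k] B)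
    (M : Type*) [AddCommGroup M] [Module B M] (m : Ideal R) : AddSubgroup M where
  carrier := {v | ∀ r ∈ m, ιB r • v = 0}
  zero_mem' := by intro r hr; simp
  add_mem' := by intro a b ha hb r hr; rw [smul_add, ha r hr, hb r hr, add_zero]
  neg_mem' := by intro a ha r hr; rw [smul_neg, ha r hr, neg_zero]

/-- `M` is a weight module: the direct sum of its weight spaces over maximal ideals. -/
def IsWeightModule {k R B : Type*} [Field k] [CommRing R] [Algebra k R]
    [Ring B] [Algebra k B] (ιB : R →ₐ[k] B)
    (M : Type*) [AddCommGroup M] [Module B M] : Prop :=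
  (⨆ m : MaximalSpectrum R, weightSpace ιB M m.asIdeal) = ⊤ ∧
    iSupIndep fun m : MaximalSpectrum R => weightSpace ιB M m.asIdeal

/-- A bundled simple weight module over `B`. -/
structure SimpleWeightWitness.{w, uk, uR, uB} (k : Type uk) [Field k] {R : Type uR}
    [CommRing R] [Algebra k R]
    (B : Type uB) [Ring B] [Algebra k B] (ιB : R →ₐ[k] B) where
  M : Type w
  [acg : AddCommGroup M]
  [mod : Module B M]
  simple : IsSimpleModule B M
  weight : IsWeightModule ιB M

attribute [instance] SimpleWeightWitness.acg SimpleWeightWitness.mod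

/-- The support of a bundled weight module. -/
def SimpleWeightWitness.supp {k : Type*} [Field k] {R : Type*} [CommRing R] [Algebra k R]
    {B : Type*} [Ring B] [Algebra k B] {ιB : R →ₐ[k] B}
    (W : SimpleWeightWitness k B ιB) : Set (MaximalSpectrum R) :=
  {m' | weightSpace ιB W.M m'.asIdeal ≠ ⊥}

/-- Isomorphism of bundled weight modules, as `B`-modules. -/
def SimpleWeightWitness.Iso {k : Type*} [Field k] {R : Type*} [CommRing R] [Algebra k R]
    {B : Type*} [Ring B] [Algebra k B] {ιB : R →ₐ[k] B}
    (W : SimpleWeightWitness k B ιB) (W' : SimpleWeightWitness k B ιB) : Prop :=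
  Nonempty (W.M ≃ₗ[B] W'.M)

/-- Gelfand–Kirillov dimension of a `k`-algebra. -/
noncomputable def GKdim (k A : Type*) [Field k] [Ring A] [Algebra k A] : ENNReal :=
  ⨆ S : Finset A, Filter.limsup
    (fun n : ℕ => ENNReal.ofReal (Real.logb n
      (Module.finrank k ↥((Submodule.span k (insert (1 : A) (S : Set A))) ^ n))))
    Filter.atTop

/-- An automorphism is locally algebraic if every orbit is contained in a
finite-dimensional subspace. -/
def LocallyAlgebraic {k R : Type*} [Field k] [Ring R] [Algebra k R]
    (σ : R ≃ₐ[k] R) : Prop :=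
  ∀ r : R, ∃ V : Submodule k R, FiniteDimensional k ↥V ∧ ∀ m : ℕ, (σ ^ m) r ∈ V

/-- The defining relations of a twisted generalized Weyl algebra of type `(A₁)ⁿ`. -/
def TGWARels (k : Type*) [Field k] {R : Type*} [Ring R] [Algebra k R] {n : ℕ}
    (σ : Fin n → R ≃ₐ[k] R) (a : Fin n → R) (γ μ : Fin n → Fin n → kˣ)
    {T : Type*} [Ring T] [Algebra k T]
    (ι : R →ₐ[k] T) (Xp Xm : Fin n → T) : Prop :=
  (∀ i (r : R), Xp i * ι r = ι (σ i r) * Xp i) ∧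
  (∀ i (r : R), Xm i * ι r = ι ((σ i)⁻¹ r) * Xm i) ∧
  (∀ i, Xm i * Xp i = ι (a i)) ∧
  (∀ i, Xp i * Xm i = ι (σ i (a i))) ∧
  (∀ i j, i ≠ j → Xp i * Xm j = ((μ i j : kˣ) : k) • (Xm j * Xp i)) ∧
  (∀ i j, i ≠ j → Xp i * Xp j = ((γ i j * (μ i j)⁻¹ : kˣ) : k) • (Xp j * Xp i)) ∧
  (∀ i j, i ≠ j → Xm j * Xm i = ((γ i j * (μ j i)⁻¹ : kˣ) : k) • (Xm i * Xm j))

/-- A realization of the twisted generalized Weyl algebra `A_μ(R, σ, a)` of type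
`(A₁)ⁿ`: it satisfies the defining relations, is `ℤⁿ`-graded with `deg Xᵢ± = ±eᵢ`,
and is universal with respect to the relations. -/
structure TGWA (k : Type*) [Field k] {R : Type*} [Ring R] [Algebra k R] {n : ℕ}
    (σ : Fin n → R ≃ₐ[k] R) (a : Fin n → R) (γ μ : Fin n → Fin n → kˣ)
    (T : Type*) [Ring T] [Algebra k T] where
  ι : R →ₐ[k] T
  Xp : Fin n → T
  Xm : Fin n → T
  rels : TGWARels k σ a γ μ ι Xp Xm
  grading : (Fin n → ℤ) → Submodule k T
  grading_internal : DirectSum.IsInternal grading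
  grading_mul : ∀ (α β : Fin n → ℤ) (x y : T),
    x ∈ grading α → y ∈ grading β → x * y ∈ grading (α + β)
  ι_mem : ∀ r, ι r ∈ grading 0
  Xp_mem : ∀ i, Xp i ∈ grading (Pi.single i 1)
  Xm_mem : ∀ i, Xm i ∈ grading (-Pi.single i 1)
  free : ∀ {C : Type} [Ring C] [Algebra k C] (ιC : R →ₐ[k] C) (Yp Ym : Fin n → C),
    TGWARels k σ a γ μ ιC Yp Ym →
    ∃! f : T →ₐ[k] C, f.comp ι = ιC ∧ (∀ i, f (Xp i) = Yp i) ∧ (∀ i, f (Xm i) = Ym i)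


section Aux

theorem list_prod_map_mul {G ι : Type*} [Monoid G] (f g : ι → G)
    (h : ∀ i j, Commute (f i) (g j)) (l : List ι) :
    (l.map fun i => f i * g i).prod = (l.map f).prod * (l.map g).prod := by
  induction l with
  | nil => simp
  | cons a l ih =>
    simp only [List.map_cons, List.prod_cons, ih]
    have hc : Commute (g a) (l.map f).prod := by
      apply Commute.list_prod_right
      intro x hx
      obtain ⟨i, -, rfl⟩ := List.mem_map.1 hx
      exact (h i a).symm
    rw [mul_assoc, ← mul_assoc (g a), hc.eq, mul_assoc, mul_assoc]

theorem tpow_add_comm {G : Type*} [Group G] {n : ℕ} (t : Fin n → G)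
    (h : ∀ i j, t i * t j = t j * t i) (α β : Fin n → ℤ) :
    ((List.finRange n).map fun i => t i ^ (α + β) i).prod =
      ((List.finRange n).map fun i => t i ^ α i).prod *
      ((List.finRange n).map fun i => t i ^ β i).prod := by
  rw [← list_prod_map_mul]
  · simp only [Pi.add_apply, zpow_add]
  · intro i j
    exact Commute.zpow_zpow (h i j) _ _

section sig
variable {k R : Type*} [Field k] [CommRing R] [Algebra k R] {n : ℕ}
  {σ : Fin n → R ≃ₐ[k] R}

theorem σpow_add (h : ∀ i j, σ i * σ j = σ j * σ i) (α β : Fin n → ℤ) :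
    σpow σ (α + β) = σpow σ α * σpow σ β := tpow_add_comm σ h α β

theorem σpow_zero : σpow σ 0 = 1 := by
  simp [σpow]

theorem σpow_single (i : Fin n) (c : ℤ) : σpow σ (Pi.single i c) = σ i ^ c := by
  unfold σpow
  rw [List.prod_map_eq_pow_single i]
  · simp [List.count_eq_one_of_mem (List.nodup_finRange n) (List.mem_finRange i)]
  · intro j hj _
    simp [Pi.single_eq_of_ne hj]

theorem σpow_neg_cancel (h : ∀ i j, σ i * σ j = σ j * σ i) (α : Fin n → ℤ) (r : R) :
    σpow σ (-α) (σpow σ α r) = r := by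
  have := σpow_add h (-α) α
  rw [neg_add_cancel, σpow_zero] at this
  exact (DFunLike.congr_fun this r).symm

theorem σpow_cancel_neg (h : ∀ i j, σ i * σ j = σ j * σ i) (α : Fin n → ℤ) (r : R) :
    σpow σ α (σpow σ (-α) r) = r := by
  have := σpow_neg_cancel h (-α) r
  rwa [neg_neg] at this

/-- The ideals of the orbit. -/
def orb (σ : Fin n → R ≃ₐ[k] R) (m0 : Ideal R) (α : Fin n → ℤ) : Ideal R :=
  Ideal.map (σpow σ α) m0

theorem mem_orb (h : ∀ i j, σ i * σ j = σ j * σ i) (m0 : Ideal R) (α : Fin n → ℤ) (r : R) :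
    r ∈ orb σ m0 α ↔ σpow σ (-α) r ∈ m0 := by
  unfold orb
  rw [Ideal.mem_map_of_equiv]
  constructor
  · rintro ⟨x, hx, rfl⟩
    rwa [σpow_neg_cancel h]
  · intro hr
    exact ⟨_, hr, σpow_cancel_neg h α r⟩

theorem σpow_mem_orb (h : ∀ i j, σ i * σ j = σ j * σ i) (m0 : Ideal R) (α γ : Fin n → ℤ) (r : R) :
    σpow σ γ r ∈ orb σ m0 (γ + α) ↔ r ∈ orb σ m0 α := by
  rw [mem_orb h, mem_orb h, ← AlgEquiv.mul_apply, ← σpow_add h]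
  congr! 3
  abel

theorem orb_maximal (σ : Fin n → R ≃ₐ[k] R) (m0 : Ideal R) (hm : m0.IsMaximal)
    (α : Fin n → ℤ) : (orb σ m0 α).IsMaximal :=
  Ideal.map_isMaximal_of_equiv _

theorem orb_inj (h : ∀ i j, σ i * σ j = σ j * σ i) (m0 : Ideal R)
    (htf : ∀ α : Fin n → ℤ, Ideal.map (σpow σ α) m0 = m0 → α = 0) {α β : Fin n → ℤ}
    (e : orb σ m0 α = orb σ m0 β) : α = β := by
  have : α - β = 0 := by
    apply htf
    ext r
    change r ∈ orb σ m0 (α - β) ↔ _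
    have h4 := mem_orb h m0 0 r
    have h7 := σpow_mem_orb h m0 0 β r
    have h8 := σpow_mem_orb h m0 (α - β) β r
    rw [neg_zero, σpow_zero] at h4
    rw [add_sub_cancel, e] at h8
    rw [add_zero] at h7
    exact h8.symm.trans (h7.trans h4)
  exact sub_eq_zero.1 this

/-- A submodule stable under the σ's other than `i`. -/
theorem stab_le_orb (h : ∀ i j, σ i * σ j = σ j * σ i) (m0 : Ideal R) (i : Fin n)
    (N : Submodule k R) (hN : ∀ j, j ≠ i → N.map (σ j).toLinearMap = N)
    {α β : Fin n → ℤ} (e : α i = β i)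
    (hle : N ≤ (orb σ m0 α).restrictScalars k) : N ≤ (orb σ m0 β).restrictScalars k := by
  let G : Subgroup (R ≃ₐ[k] R) :=
    { carrier := {f | ∀ x, f x ∈ N ↔ x ∈ N}
      one_mem' := fun x => Iff.rfl
      mul_mem' := fun {f g} hf hg x => (hf (g x)).trans (hg x)
      inv_mem' := fun {f} hf x => by
        rw [← hf]
        change f (f.symm x) ∈ N ↔ _
        rw [AlgEquiv.apply_symm_apply] }
  have hG : ∀ j, j ≠ i → σ j ∈ G := by
    intro j hj x
    constructor
    · intro hx
      rw [← hN j hj] at hx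
      obtain ⟨y, hy, hyx⟩ := hx
      have : y = x := (σ j).injective hyx
      exact this ▸ hy
    · intro hx
      rw [← hN j hj]
      exact ⟨x, hx, rfl⟩
  have hm : σpow σ (α - β) ∈ G := by
    apply Subgroup.list_prod_mem
    intro x hx
    obtain ⟨j, -, rfl⟩ := List.mem_map.1 hx
    by_cases hj : j = i
    · subst hj
      simp [e, G.one_mem]
    · exact G.zpow_mem (hG j hj) _
  intro x hx
  have h1 := hle ((hm x).2 hx)
  have h2 : σpow σ (α - β) x ∈ orb σ m0 ((α - β) + β) := by
    rw [sub_add_cancel]; exact h1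
  exact (σpow_mem_orb h m0 _ _ _).1 h2

theorem mul_le_prime {P : Ideal R} (hP : P.IsPrime) (N N' : Submodule k R) :
    N * N' ≤ P.restrictScalars k ↔ N ≤ P.restrictScalars k ∨ N' ≤ P.restrictScalars k := by
  constructor
  · intro h
    by_contra! hc
    obtain ⟨x, hx, hx'⟩ := Set.not_subset.1 hc.1
    obtain ⟨y, hy, hy'⟩ := Set.not_subset.1 hc.2
    rcases hP.mem_or_mem (h (Submodule.mul_mem_mul hx hy) : x * y ∈ P) with h1 | h1
    · exact hx' h1
    · exact hy' h1
  · rintro (h | h)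
    · rw [Submodule.mul_le]
      intro x hx y hy
      exact P.mul_mem_right _ (h hx)
    · rw [Submodule.mul_le]
      intro x hx y hy
      exact P.mul_mem_left _ (h hy)

theorem list_prod_le_prime {P : Ideal R} (hP : P.IsPrime) (l : List (Submodule k R)) :
    l.prod ≤ P.restrictScalars k ↔ ∃ N ∈ l, N ≤ P.restrictScalars k := by
  induction l with
  | nil =>
    simp only [List.prod_nil, List.not_mem_nil, false_and, exists_false, iff_false]
    intro h
    exact hP.ne_top ((Ideal.eq_top_iff_one _).2 (h (Submodule.one_le.1 le_rfl)))
  | cons a l ih => simp [mul_le_prime hP, ih]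

theorem map_le_orb (h : ∀ i j, σ i * σ j = σ j * σ i) (m0 : Ideal R) (i : Fin n) (c : ℤ)
    (N : Submodule k R) (α : Fin n → ℤ) :
    N.map (σ i ^ c).toLinearMap ≤ (orb σ m0 α).restrictScalars k ↔
      N ≤ (orb σ m0 (α - Pi.single i c)).restrictScalars k := by
  rw [Submodule.map_le_iff_le_comap, ← σpow_single]
  refine forall₂_congr fun x _ => ?_
  have := σpow_mem_orb h m0 (α - Pi.single i c) (Pi.single i c) x
  rw [add_sub_cancel] at this
  exact this

theorem map_le_orb' (h : ∀ i j, σ i * σ j = σ j * σ i) (m0 : Ideal R) (i : Fin n) (c : ℤ)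
    (N : Submodule k R) (hN : ∀ j, j ≠ i → N.map (σ j).toLinearMap = N) (α : Fin n → ℤ) :
    N.map (σ i ^ c).toLinearMap ≤ (orb σ m0 α).restrictScalars k ↔
      N ≤ (orb σ m0 (Pi.single i (α i - c))).restrictScalars k := by
  rw [map_le_orb h]
  constructor <;> intro hh <;> refine stab_le_orb h m0 i N hN ?_ hh <;> simp

theorem mem_castRange (N : ℕ) (j : ℤ) :
    (j ∈ (do let a ← List.range N; pure (a : ℤ) : List ℤ)) ↔ 0 ≤ j ∧ j < N := by
  simp only [List.bind_eq_flatMap, List.pure_def, List.mem_flatMap, List.mem_range,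
    List.mem_singleton]
  constructor
  · rintro ⟨a, h, rfl⟩
    omega
  · rintro ⟨h1, h2⟩
    exact ⟨j.toNat, by omega, by omega⟩

theorem seg_pos_le (h : ∀ i j, σ i * σ j = σ j * σ i) {m0 : Ideal R} (hm : m0.IsMaximal)
    (i : Fin n) (H J : Submodule k R) (hN : ∀ j, j ≠ i → J.map (σ j).toLinearMap = J)
    (m : ℤ) (hpos : 0 < m) (α : Fin n → ℤ) :
    seg (σ i) H J m ≤ (orb σ m0 α).restrictScalars k ↔
      ∃ d : ℤ, α i - m < d ∧ d ≤ α i ∧ J ≤ (orb σ m0 (Pi.single i d)).restrictScalars k := by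
  rw [seg, if_pos hpos, list_prod_le_prime (orb_maximal σ m0 hm α).isPrime]
  simp only [List.mem_map, mem_castRange, exists_exists_and_eq_and, map_le_orb' h m0 i _ J hN]
  constructor
  · rintro ⟨j, hj, hle⟩
    exact ⟨_, by omega, by omega, hle⟩
  · rintro ⟨d, h1, h2, hle⟩
    refine ⟨α i - d, by omega, ?_⟩
    rw [show α i - (α i - d) = d by omega]
    exact hle

theorem seg_neg_le (h : ∀ i j, σ i * σ j = σ j * σ i) {m0 : Ideal R} (hm : m0.IsMaximal)
    (i : Fin n) (H J : Submodule k R) (hN : ∀ j, j ≠ i → H.map (σ j).toLinearMap = H)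
    (m : ℤ) (hneg : m < 0) (α : Fin n → ℤ) :
    seg (σ i) H J m ≤ (orb σ m0 α).restrictScalars k ↔
      ∃ d : ℤ, α i < d ∧ d ≤ α i - m ∧ H ≤ (orb σ m0 (Pi.single i d)).restrictScalars k := by
  rw [seg, if_neg (by omega), if_neg (by omega),
    list_prod_le_prime (orb_maximal σ m0 hm α).isPrime]
  simp only [List.mem_map, mem_castRange, exists_exists_and_eq_and, map_le_orb' h m0 i _ H hN]
  constructor
  · rintro ⟨j, hj, hle⟩
    exact ⟨_, by omega, by omega, hle⟩
  · rintro ⟨d, h1, h2, hle⟩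
    refine ⟨d - α i - 1, by omega, ?_⟩
    rw [show α i - (-((d - α i - 1) + 1)) = d by omega]
    exact hle

/-- Two points of the orbit are connected. -/
def Conn (σ : Fin n → R ≃ₐ[k] R) (H J : Fin n → Submodule k R) (m0 : Ideal R)
    (α β : Fin n → ℤ) : Prop :=
  ¬ segVec σ H J (β - α) ≤ (orb σ m0 β).restrictScalars k ∧
  ¬ segVec σ H J (-(β - α)) ≤ (orb σ m0 α).restrictScalars k

theorem conn_iff {p : Fin n → Fin n → kˣ} {H J : Fin n → Submodule k R}
    (hD : IsBRDatum σ p H J) {m0 : Ideal R} (hm0 : m0.IsMaximal)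
    (breakSet : Fin n → Set ℤ)
    (hbreakSet : ∀ (i : Fin n) (c : ℤ), c ∈ breakSet i ↔
      (H i * J i : Submodule k R) ≤ Submodule.restrictScalars k
        (Ideal.map (σpow σ (Pi.single i (c + 1))) m0))
    (α β : Fin n → ℤ) :
    Conn σ H J m0 α β ↔
      ∀ i, ∀ c ∈ breakSet i, ¬ (min (α i) (β i) ≤ c ∧ c < max (α i) (β i)) := by
  have hb : ∀ i c, c ∈ breakSet i ↔
      H i ≤ (orb σ m0 (Pi.single i (c + 1))).restrictScalars k ∨
      J i ≤ (orb σ m0 (Pi.single i (c + 1))).restrictScalars k := by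
    intro i c
    rw [hbreakSet]
    exact mul_le_prime (orb_maximal σ m0 hm0 _).isPrime _ _
  unfold Conn segVec
  rw [list_prod_le_prime (orb_maximal σ m0 hm0 _).isPrime,
    list_prod_le_prime (orb_maximal σ m0 hm0 _).isPrime]
  simp only [List.mem_map, List.mem_finRange, true_and, exists_exists_eq_and, not_exists]
  rw [← forall_and]
  refine forall_congr' fun i => ?_
  have hH : ∀ j, j ≠ i → (H i).map (σ j).toLinearMap = H i := fun j hj => hD.mapH j i hj
  have hJ : ∀ j, j ≠ i → (J i).map (σ j).toLinearMap = J i := fun j hj => hD.mapJ j i hj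
  simp only [hb]
  have htop : ∀ γ, ¬ seg (σ i) (H i) (J i) 0 ≤ (orb σ m0 γ).restrictScalars k := by
    intro γ hle
    have : (1 : R) ∈ orb σ m0 γ := hle (by simp [seg])
    exact (orb_maximal σ m0 hm0 γ).ne_top ((Ideal.eq_top_iff_one _).2 this)
  rcases lt_trichotomy (α i) (β i) with hlt | heq | hlt
  · rw [seg_pos_le hD.comm hm0 i _ _ hJ _ (by simpa using hlt),
      seg_neg_le hD.comm hm0 i _ _ hH _ (by simpa using hlt)]
    simp only [Pi.sub_apply, Pi.neg_apply, min_eq_left hlt.le, max_eq_right hlt.le]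
    constructor
    · rintro ⟨h1, h2⟩ c (hc | hc) ⟨hc1, hc2⟩
      · exact h2 ⟨c + 1, by omega, by omega, hc⟩
      · exact h1 ⟨c + 1, by omega, by omega, hc⟩
    · intro hh
      constructor
      · rintro ⟨d, h1, h2, h3⟩
        exact hh (d - 1) (Or.inr (by rwa [sub_add_cancel])) ⟨by omega, by omega⟩
      · rintro ⟨d, h1, h2, h3⟩
        exact hh (d - 1) (Or.inl (by rwa [sub_add_cancel])) ⟨by omega, by omega⟩
  · have e1 : (β - α) i = 0 := by simp [heq]
    have e2 : (-(β - α)) i = 0 := by simp [heq]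
    rw [e1, e2]
    refine iff_of_true ⟨htop _, htop _⟩ ?_
    rintro c - ⟨h1, h2⟩
    simp only [heq, min_self, max_self] at h1 h2
    omega
  · rw [seg_neg_le hD.comm hm0 i _ _ hH _ (by simpa using hlt),
      seg_pos_le hD.comm hm0 i _ _ hJ _ (by simpa using hlt)]
    simp only [Pi.sub_apply, Pi.neg_apply, min_eq_right hlt.le, max_eq_left hlt.le]
    constructor
    · rintro ⟨h1, h2⟩ c (hc | hc) ⟨hc1, hc2⟩
      · exact h1 ⟨c + 1, by omega, by omega, hc⟩
      · exact h2 ⟨c + 1, by omega, by omega, hc⟩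
    · intro hh
      constructor
      · rintro ⟨d, h1, h2, h3⟩
        exact hh (d - 1) (Or.inl (by rwa [sub_add_cancel])) ⟨by omega, by omega⟩
      · rintro ⟨d, h1, h2, h3⟩
        exact hh (d - 1) (Or.inr (by rwa [sub_add_cancel])) ⟨by omega, by omega⟩

end sig

/-! Combinatorics of a single coordinate -/

def box1 (S : Set ℤ) (o : Option ℤ) (a : ℤ) : Prop :=
  o.elim (∀ c ∈ S, c < a) (fun c => a ≤ c ∧ ∀ c' ∈ S, ¬(a ≤ c' ∧ c' < c))

def valid1 (S : Set ℤ) (o : Option ℤ) : Prop :=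
  (∀ c : ℤ, o = some c → c ∈ S) ∧ (o = none → BddAbove S)

theorem box1_exists (S : Set ℤ) (a : ℤ) : ∃ o, valid1 S o ∧ box1 S o a := by
  by_cases hS : ∃ c ∈ S, a ≤ c
  · obtain ⟨c, ⟨hc1, hc2⟩, hc3⟩ := Int.exists_least_of_bdd (P := fun c => c ∈ S ∧ a ≤ c)
      ⟨a, fun z hz => hz.2⟩ (by obtain ⟨c, h1, h2⟩ := hS; exact ⟨c, h1, h2⟩)
    refine ⟨some c, ⟨?_, by simp⟩, hc2, ?_⟩
    · rintro c' h
      cases h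
      exact hc1
    · rintro c' hc' ⟨h1, h2⟩
      have := hc3 c' ⟨hc', h1⟩
      omega
  · push Not at hS
    exact ⟨none, ⟨by simp, fun _ => ⟨a, fun c hc => (hS c hc).le⟩⟩, hS⟩

theorem box1_iff {S : Set ℤ} {o : Option ℤ} (hv : valid1 S o) {a : ℤ} (ha : box1 S o a) (b : ℤ) :
    box1 S o b ↔ ∀ c ∈ S, ¬ (min a b ≤ c ∧ c < max a b) := by
  cases o with
  | none =>
    simp only [box1, Option.elim] at ha ⊢
    constructor
    · intro hb c hc h
      have := ha c hc
      have := hb c hc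
      omega
    · intro h c hc
      have := ha c hc
      have := h c hc
      omega
  | some d =>
    have hd := hv.1 d rfl
    simp only [box1, Option.elim] at ha ⊢
    constructor
    · intro hb c hc h
      have := ha.2 c hc
      have := hb.2 c hc
      omega
    · intro h
      have := h d hd
      refine ⟨by omega, fun c hc h' => ?_⟩
      have := h c hc
      have := ha.2 c hc
      omega

theorem box1_unique {S : Set ℤ} {o o' : Option ℤ} (hv : valid1 S o) (hv' : valid1 S o')
    {a : ℤ} (ha : box1 S o a) (ha' : box1 S o' a) : o = o' := by
  cases o with
  | none =>
    cases o' with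
    | none => rfl
    | some d' =>
      have h1 := ha _ (hv'.1 d' rfl)
      have h2 := ha'.1
      omega
  | some d =>
    cases o' with
    | none =>
      have h1 := ha' _ (hv.1 d rfl)
      have h2 := ha.1
      omega
    | some d' =>
      have h1 := ha'.2 _ (hv.1 d rfl)
      have h2 := ha.2 _ (hv'.1 d' rfl)
      have h3 := ha.1
      have h4 := ha'.1
      congr 1
      omega

theorem box1_nonempty {S : Set ℤ} {o : Option ℤ} (hv : valid1 S o) : ∃ a, box1 S o a := by
  cases o with
  | none =>
    obtain ⟨b, hb⟩ := hv.2 rfl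
    exact ⟨b + 1, fun c hc => by have := hb hc; omega⟩
  | some d => exact ⟨d, le_rfl, fun c' _ h => by omega⟩

section alg
variable {k R A : Type*} [Field k] [CommRing R] [Algebra k R] [Ring A] [Algebra k A]
    {n : ℕ} {σ : Fin n → R ≃ₐ[k] R} {p : Fin n → Fin n → kˣ}

theorem tpow_comm (E : SkewLaurent k σ p A) (γ : Fin n → ℤ) (r : R) :
    (tpow E.t γ : A) * E.ι r = E.ι (σpow σ γ r) * (tpow E.t γ : A) := by
  let G : Subgroup (Aˣ × (R ≃ₐ[k] R)) :=
    { carrier := {x | ∀ r, (x.1 : A) * E.ι r = E.ι (x.2 r) * (x.1 : A)}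
      one_mem' := fun r => by simp
      mul_mem' := fun {x y} hx hy r => by
        change ((x.1 : A) * (y.1 : A)) * E.ι r = E.ι (x.2 (y.2 r)) * ((x.1 : A) * (y.1 : A))
        rw [mul_assoc, hy, ← mul_assoc, hx, mul_assoc]
      inv_mem' := fun {x} hx r => by
        change ((x.1⁻¹ : Aˣ) : A) * E.ι r = E.ι (x.2.symm r) * ((x.1⁻¹ : Aˣ) : A)
        have h := hx (x.2.symm r)
        rw [AlgEquiv.apply_symm_apply] at h
        rw [Units.inv_mul_eq_iff_eq_mul, ← mul_assoc, h, mul_assoc, Units.mul_inv, mul_one] }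
  have key : ∀ l : List (Fin n), ((l.map fun i => E.t i ^ γ i).prod,
      (l.map fun i => σ i ^ γ i).prod) ∈ G := by
    intro l
    induction l with
    | nil => exact G.one_mem
    | cons a l ih =>
      have h1 : (E.t a, σ a) ∈ G := fun r => E.rel_r a r
      have h2 := G.mul_mem (G.zpow_mem h1 (γ a)) ih
      simpa using h2
  exact key _ r

theorem tpow_neg (E : SkewLaurent k σ p A) (γ : Fin n → ℤ) :
    ∃ u : kˣ, (tpow E.t (-γ) : A) * (tpow E.t γ : A) = algebraMap k A u := by
  let Z : Subgroup Aˣ := (Units.map (algebraMap k A : k →* A)).range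
  have hcent : ∀ z ∈ Z, ∀ g : Aˣ, g * z = z * g := by
    rintro _ ⟨u, rfl⟩ g
    ext
    exact (Algebra.commutes (u : k) (g : A)).symm
  have hZ : Z.Normal := ⟨fun z hz g => by
    rw [hcent z hz g, mul_assoc, mul_inv_cancel, mul_one]; exact hz⟩
  have hcomm : ∀ i j, (QuotientGroup.mk' Z (E.t i)) * (QuotientGroup.mk' Z (E.t j)) =
      (QuotientGroup.mk' Z (E.t j)) * (QuotientGroup.mk' Z (E.t i)) := by
    intro i j
    by_cases hij : i = j
    · rw [hij]
    · rw [← map_mul, ← map_mul]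
      symm
      apply (QuotientGroup.eq).2
      rw [← Z.inv_mem_iff]
      refine ⟨p i j, ?_⟩
      have h := E.rel_t i j hij
      have h2 : E.t j * E.t i =
          Units.map (algebraMap k A : k →* A) (p i j) * (E.t i * E.t j) := by
        ext
        exact h
      rw [mul_inv_rev, inv_inv, h2, ← hcent _ ⟨p i j, rfl⟩, inv_mul_cancel_left]
  have hmap : ∀ γ : Fin n → ℤ, QuotientGroup.mk' Z (tpow E.t γ) =
      ((List.finRange n).map fun i => (QuotientGroup.mk' Z (E.t i)) ^ γ i).prod := by
    intro γ
    unfold tpow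
    rw [map_list_prod, List.map_map]
    rfl
  have h1 := tpow_add_comm (fun i => QuotientGroup.mk' Z (E.t i)) hcomm (-γ) γ
  rw [← hmap, ← hmap (-γ), ← hmap γ, ← map_mul] at h1
  have h2 : QuotientGroup.mk' Z (tpow E.t (-γ) * tpow E.t γ) = 1 := by
    rw [← h1, neg_add_cancel]; simp [tpow]
  have h3 : tpow E.t (-γ) * tpow E.t γ ∈ Z := (QuotientGroup.eq_one_iff _).1 h2
  obtain ⟨u, hu⟩ := h3
  refine ⟨u, ?_⟩
  have := congrArg Units.val hu
  exact this.symm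

/-- Sum map from coefficient families. -/
noncomputable def sumHom (E : SkewLaurent k σ p A) : ((Fin n → ℤ) →₀ R) →+ A :=
  Finsupp.liftAddHom fun α =>
    (AddMonoidHom.mulRight (tpow E.t α : A)).comp (E.ι : R →+ A)

theorem sumHom_apply (E : SkewLaurent k σ p A) (c : (Fin n → ℤ) →₀ R) :
    sumHom E c = c.sum fun α r => E.ι r * (tpow E.t α : A) := rfl

theorem sumHom_bij (E : SkewLaurent k σ p A) : Function.Bijective (sumHom E) := by
  constructor
  · rw [injective_iff_map_eq_zero]
    exact fun c hc => E.repr_free c hc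
  · intro a
    obtain ⟨c, hc⟩ := E.repr_exists a
    exact ⟨c, hc.symm⟩

noncomputable def coef (E : SkewLaurent k σ p A) (γ : Fin n → ℤ) : A →+ R :=
  (Finsupp.applyAddHom γ).comp
    ((AddEquiv.ofBijective (sumHom E) (sumHom_bij E)).symm : A →+ ((Fin n → ℤ) →₀ R))

theorem coef_mono (E : SkewLaurent k σ p A) (γ δ : Fin n → ℤ) (r : R) :
    coef E γ (E.ι r * (tpow E.t δ : A)) = Finsupp.single δ r γ := by
  have h : sumHom E (Finsupp.single δ r) = E.ι r * (tpow E.t δ : A) := by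
    rw [sumHom_apply, Finsupp.sum_single_index]
    simp
  rw [← h]
  have h2 : (AddEquiv.ofBijective (sumHom E) (sumHom_bij E)).symm
      (sumHom E (Finsupp.single δ r)) = Finsupp.single δ r :=
    (AddEquiv.ofBijective (sumHom E) (sumHom_bij E)).symm_apply_apply _
  change ((AddEquiv.ofBijective (sumHom E) (sumHom_bij E)).symm
      (sumHom E (Finsupp.single δ r))) γ = _
  rw [h2]

variable {H J : Fin n → Submodule k R} 
    (E : SkewLaurent k σ p A) (B : Subalgebra k A)
    (hB : Subalgebra.toSubmodule B = brSubmodule E H J)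

/-- Homogeneous elements of `B`. -/
noncomputable def gen (γ : Fin n → ℤ) (r : R) (h : r ∈ segVec σ H J γ) : ↥B :=
  ⟨E.ι r * (tpow E.t γ : A), by
    rw [← Subalgebra.mem_toSubmodule, hB]
    exact Submodule.mem_iSup_of_mem γ ⟨_, ⟨r, h, rfl⟩, rfl⟩⟩

theorem gen_induction {P : ↥B → Prop} (h0 : P 0) (ha : ∀ x y, P x → P y → P (x + y))
    (hg : ∀ γ r h, P (gen E B hB γ r h)) (b : ↥B) : P b := by
  obtain ⟨b, hb⟩ := b
  have hb' : b ∈ ⨆ α : Fin n → ℤ, brComponent E H J α := by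
    change b ∈ brSubmodule E H J
    rw [← hB]; exact hb
  have : ∃ h : b ∈ B, P ⟨b, h⟩ := by
    refine Submodule.iSup_induction _ (motive := fun b => ∃ h : b ∈ B, P ⟨b, h⟩) hb' ?_ ?_ ?_
    · rintro γ x ⟨_, ⟨r, hr, rfl⟩, rfl⟩
      exact ⟨(gen E B hB γ r hr).2, hg γ r hr⟩
    · exact ⟨B.zero_mem, h0⟩
    · rintro x y ⟨hx, hx'⟩ ⟨hy, hy'⟩
      exact ⟨B.add_mem hx hy, ha _ _ hx' hy'⟩
  exact this.2

theorem gen_congr {γ : Fin n → ℤ} {r s : R} (e : r = s) (hr : r ∈ segVec σ H J γ)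
    (hs : s ∈ segVec σ H J γ) : gen E B hB γ r hr = gen E B hB γ s hs := by
  subst e; rfl

variable (hc : ∀ i j, σ i * σ j = σ j * σ i)
    (ιB : R →ₐ[k] ↥B) (hιB : ∀ r : R, ((ιB r : ↥B) : A) = E.ι r)
    (m0 : Ideal R) (hm0 : m0.IsMaximal)

include hc hιB in
theorem ι_mul_gen (γ : Fin n → ℤ) (r s : R) (h : r ∈ segVec σ H J γ) :
    ιB s * gen E B hB γ r h = gen E B hB γ r h * ιB (σpow σ (-γ) s) := by
  ext
  simp only [MulMemClass.coe_mul, hιB, gen]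
  rw [mul_assoc, tpow_comm, σpow_cancel_neg hc, ← mul_assoc, ← mul_assoc, ← map_mul, ← map_mul,
    mul_comm]

include hιB in
theorem gen_mul_gen (γ : Fin n → ℤ) (r s : R) (h : r ∈ segVec σ H J γ)
    (h' : s ∈ segVec σ H J (-γ)) : ∃ u : kˣ, gen E B hB (-γ) s h' * gen E B hB γ r h =
      ιB (algebraMap k R u * (s * σpow σ (-γ) r)) := by
  obtain ⟨u, hu⟩ := tpow_neg E γ
  refine ⟨u, ?_⟩
  ext
  simp only [MulMemClass.coe_mul, hιB, gen]
  rw [mul_assoc, ← mul_assoc _ (E.ι r), tpow_comm, mul_assoc, hu, map_mul, map_mul,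
    AlgHom.commutes, Algebra.commutes, mul_assoc]

/-- Points of the orbit as elements of the maximal spectrum. -/
def orbM (σ : Fin n → R ≃ₐ[k] R) (m0 : Ideal R) (hm0 : m0.IsMaximal) (α : Fin n → ℤ) :
    MaximalSpectrum R := ⟨orb σ m0 α, orb_maximal σ m0 hm0 α⟩

variable {W : Type*} [AddCommGroup W] [Module ↥B W]

include hc hιB in
theorem gen_smul_mem {α : Fin n → ℤ} {v : W} (hv : v ∈ weightSpace ιB W (orb σ m0 α))
    (γ : Fin n → ℤ) (r : R) (h : r ∈ segVec σ H J γ) :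
    gen E B hB γ r h • v ∈ weightSpace ιB W (orb σ m0 (γ + α)) := by
  intro s hs
  rw [smul_smul, ι_mul_gen E B hB hc ιB hιB, mul_smul]
  rw [hv _ _, smul_zero]
  have := σpow_mem_orb hc m0 (γ + α) (-γ) s
  rw [neg_add_cancel_left] at this
  exact this.2 hs

theorem smul_eq_zero_iff' {B W : Type*} [Ring B] [Algebra k B] [AddCommGroup W] [Module B W]
    (ιB : R →ₐ[k] B) {m : Ideal R} (hm : m.IsMaximal) {v : W}
    (hv : v ∈ weightSpace ιB W m) (hv0 : v ≠ 0) (r : R) : ιB r • v = 0 ↔ r ∈ m := by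
  refine ⟨fun h => ?_, fun h => hv r h⟩
  by_contra hr
  obtain ⟨x, i, hi, hx⟩ := hm.exists_inv hr
  apply hv0
  have : v = ιB 1 • v := by rw [map_one, one_smul]
  rw [this, ← hx, map_add, map_mul, add_smul, mul_smul, h, smul_zero, zero_add]
  exact hv _ hi

/-- Sum of the other weight spaces. -/
def oth {B W : Type*} [Ring B] [Algebra k B] [AddCommGroup W] [Module B W]
    (ιB : R →ₐ[k] B) (m : MaximalSpectrum R) : AddSubgroup W :=
  ⨆ (m' : MaximalSpectrum R) (_ : m' ≠ m), weightSpace ιB W m'.asIdeal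

theorem mem_oth {B W : Type*} [Ring B] [Algebra k B] [AddCommGroup W] [Module B W]
    (ιB : R →ₐ[k] B) {m m' : MaximalSpectrum R} (h : m' ≠ m) {v : W}
    (hv : v ∈ weightSpace ιB W m'.asIdeal) : v ∈ oth (W := W) ιB m :=
  (le_iSup₂_of_le (f := fun (m' : MaximalSpectrum R) (_ : m' ≠ m) => weightSpace ιB W m'.asIdeal)
    m' h le_rfl) hv

theorem weight_indep {B W : Type*} [Ring B] [Algebra k B] [AddCommGroup W] [Module B W]
    (ιB : R →ₐ[k] B) :
    iSupIndep fun m : MaximalSpectrum R => weightSpace ιB W m.asIdeal := by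
  let _ : Module R W := Module.compHom W (ιB : R →+* B)
  have h1 : iSupIndep fun m : MaximalSpectrum R =>
      Submodule.torsionBySet R W (m.asIdeal : Set R) := by
    rw [iSupIndep_iff_supIndep]
    intro s
    apply Submodule.supIndep_torsionBySet_ideal
    intro m _ m' _ hne
    exact Ideal.isCoprime_iff_sup_eq.1
      ((Ideal.isCoprime_of_isMaximal (I := m.asIdeal) (J := m'.asIdeal))
        fun e => hne (MaximalSpectrum.ext e))
  have hle : ∀ m : MaximalSpectrum R, weightSpace ιB W m.asIdeal =
      (Submodule.torsionBySet R W (m.asIdeal : Set R)).toAddSubgroup := by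
    intro m
    ext v
    simp only [Submodule.mem_toAddSubgroup, Submodule.mem_torsionBySet_iff]
    exact ⟨fun h r => h r.1 r.2, fun h r hr => h ⟨r, hr⟩⟩
  intro m
  rw [AddSubgroup.disjoint_def]
  intro x hx hx'
  have h2 := Submodule.disjoint_def.1 (h1 m) x
  refine h2 (by change x ∈ weightSpace ιB W m.asIdeal at hx; rw [hle m] at hx; exact hx) ?_
  have h3 : (⨆ (j : MaximalSpectrum R) (_ : j ≠ m), weightSpace ιB W j.asIdeal) ≤
      (⨆ (j : MaximalSpectrum R) (_ : j ≠ m),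
        Submodule.torsionBySet R W (j.asIdeal : Set R)).toAddSubgroup := by
    refine iSup₂_le fun j hj => ?_
    rw [hle j]
    exact le_iSup₂_of_le (f := fun (j : MaximalSpectrum R) (_ : j ≠ m) =>
      Submodule.torsionBySet R W (j.asIdeal : Set R)) j hj le_rfl
  exact h3 hx'

theorem eq_zero_of_oth {B W : Type*} [Ring B] [Algebra k B] [AddCommGroup W] [Module B W]
    (ιB : R →ₐ[k] B) {m : MaximalSpectrum R} {v : W}
    (hv : v ∈ weightSpace ιB W m.asIdeal) (hv' : v ∈ oth (W := W) ιB m) : v = 0 :=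
  AddSubgroup.disjoint_def.1 (weight_indep ιB m) hv hv'

variable (htf : ∀ α : Fin n → ℤ, Ideal.map (σpow σ α) m0 = m0 → α = 0)

include hc hιB htf in
theorem decomp {α : Fin n → ℤ} {v : W} (hv : v ∈ weightSpace ιB W (orb σ m0 α))
    (γ : Fin n → ℤ) (b : ↥B) :
    ∃ h : coef E γ (b : A) ∈ segVec σ H J γ,
      b • v - gen E B hB γ _ h • v ∈ oth (W := W) ιB (orbM σ m0 hm0 (γ + α)) := by
  induction b using gen_induction E B hB with
  | h0 =>
    refine ⟨by simp, ?_⟩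
    have : gen (H := H) (J := J) E B hB γ (coef E γ ((0 : ↥B) : A)) (by simp) = 0 := by
      ext; simp [gen]
    rw [this]; simp
  | ha x y hx hy =>
    obtain ⟨hx, hx'⟩ := hx
    obtain ⟨hy, hy'⟩ := hy
    have hxy : coef E γ ((x + y : ↥B) : A) ∈ segVec σ H J γ := by
      rw [AddMemClass.coe_add, map_add]
      exact add_mem hx hy
    refine ⟨hxy, ?_⟩
    have : gen E B hB γ _ hxy = gen E B hB γ _ hx + gen E B hB γ _ hy := by
      ext; simp [gen, add_mul]
    rw [this, add_smul, add_smul, add_sub_add_comm]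
    exact add_mem hx' hy'
  | hg δ r h =>
    have e : coef E γ (gen E B hB δ r h : A) = Finsupp.single δ r γ := coef_mono E γ δ r
    by_cases hδ : δ = γ
    · subst hδ
      rw [Finsupp.single_eq_same] at e
      have h2 : coef E δ (gen E B hB δ r h : A) ∈ segVec σ H J δ := by rw [e]; exact h
      refine ⟨h2, ?_⟩
      rw [gen_congr E B hB e h2 h, sub_self]
      exact zero_mem _
    · rw [Finsupp.single_eq_of_ne (Ne.symm hδ)] at e
      have h2 : coef E γ (gen E B hB δ r h : A) ∈ segVec σ H J γ := by rw [e]; exact zero_mem _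
      refine ⟨h2, ?_⟩
      have h3 : gen E B hB γ _ h2 = 0 := by
        rw [gen_congr E B hB e h2 (zero_mem _)]
        ext; simp [gen]
      rw [h3, zero_smul, sub_zero]
      refine mem_oth ιB (m' := orbM σ m0 hm0 (δ + α)) ?_
        (gen_smul_mem E B hB hc ιB hιB m0 hv δ r h)
      intro he
      apply hδ
      have := orb_inj hc m0 htf (congrArg MaximalSpectrum.asIdeal he)
      exact add_right_cancel this

include hc hιB htf hm0 in
/-- If `b v = w` for weight vectors then a homogeneous element already does it. -/
theorem exists_gen {α γ : Fin n → ℤ} {v : W} (hv : v ∈ weightSpace ιB W (orb σ m0 α))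
    (b : ↥B) (hw : b • v ∈ weightSpace ιB W (orb σ m0 (γ + α))) :
    ∃ h : coef E γ (b : A) ∈ segVec σ H J γ, b • v = gen E B hB γ _ h • v := by
  obtain ⟨h, hh⟩ := decomp E B hB hc ιB hιB m0 hm0 htf hv γ b
  refine ⟨h, sub_eq_zero.1 (eq_zero_of_oth ιB (m := orbM σ m0 hm0 (γ + α)) ?_ hh)⟩
  exact sub_mem hw (gen_smul_mem E B hB hc ιB hιB m0 hv _ _ _)

include hc hιB htf hB hm0 in
theorem conn_iff_mem [IsSimpleModule ↥B W] {α : Fin n → ℤ} {v : W}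
    (hv : v ∈ weightSpace ιB W (orb σ m0 α)) (hv0 : v ≠ 0) (β : Fin n → ℤ) :
    weightSpace ιB W (orb σ m0 β) ≠ ⊥ ↔ Conn σ H J m0 α β := by
  obtain ⟨γ, rfl⟩ : ∃ γ, β = γ + α := ⟨β - α, by simp⟩
  unfold Conn
  rw [add_sub_cancel_right]
  constructor
  · intro hne
    obtain ⟨w, hw, hw0⟩ := (AddSubgroup.bot_or_exists_ne_zero _).resolve_left hne
    obtain ⟨b, hb⟩ := IsSimpleModule.toSpanSingleton_surjective ↥B hv0 w
    obtain ⟨c, hcw⟩ := IsSimpleModule.toSpanSingleton_surjective ↥B hw0 v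
    rw [LinearMap.toSpanSingleton_apply] at hb hcw
    obtain ⟨h1, e1⟩ := exists_gen E B hB hc ιB hιB m0 hm0 htf hv b (γ := γ) (by rw [hb]; exact hw)
    obtain ⟨h2, e2⟩ := exists_gen E B hB hc ιB hιB m0 hm0 htf hw c (γ := -γ)
      (by rw [hcw, neg_add_cancel_left]; exact hv)
    rw [hb] at e1
    rw [hcw, e1, smul_smul] at e2
    obtain ⟨u, hu⟩ := gen_mul_gen E B hB ιB hιB γ _ _ h1 h2
    rw [hu] at e2
    have key : ¬ (algebraMap k R u * (coef E (-γ) (c : A) * σpow σ (-γ) (coef E γ (b : A)))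
        ∈ orb σ m0 α) := by
      intro hmem
      rw [hv _ hmem] at e2
      exact hv0 e2
    constructor
    · intro hle
      apply key
      have h3 : coef E γ (b : A) ∈ orb σ m0 (γ + α) := hle h1
      rw [← σpow_mem_orb hc m0 (γ + α) (-γ), neg_add_cancel_left] at h3
      exact Ideal.mul_mem_left _ _ (Ideal.mul_mem_left _ _ h3)
    · intro hle
      apply key
      have h3 : coef E (-γ) (c : A) ∈ orb σ m0 α := hle h2
      exact Ideal.mul_mem_left _ _ (Ideal.mul_mem_right _ _ h3)
  · rintro ⟨hn1, hn2⟩ hbot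
    obtain ⟨r, hr, hr'⟩ := Set.not_subset.1 hn1
    obtain ⟨s, hs, hs'⟩ := Set.not_subset.1 hn2
    have h1 := gen_smul_mem E B hB hc ιB hιB m0 hv γ r hr
    rw [hbot, AddSubgroup.mem_bot] at h1
    obtain ⟨u, hu⟩ := gen_mul_gen E B hB ιB hιB γ r s hr hs
    have h2 : ιB (algebraMap k R u * (s * σpow σ (-γ) r)) • v = 0 := by
      rw [← hu, mul_smul, h1, smul_zero]
    have hmax := orb_maximal σ m0 hm0 α
    rw [smul_eq_zero_iff' ιB hmax hv hv0] at h2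
    rcases hmax.isPrime.mem_or_mem h2 with h3 | h3
    · exact hmax.ne_top (Ideal.eq_top_of_isUnit_mem _ h3 (u.isUnit.map _))
    · rcases hmax.isPrime.mem_or_mem h3 with h4 | h4
      · exact hs' h4
      · apply hr'
        have h5 := σpow_mem_orb hc m0 (γ + α) (-γ) r
        rw [neg_add_cancel_left] at h5
        exact h5.1 h4

include hιB in
theorem gen_zero_eq (r : R) (h : r ∈ segVec σ H J 0) : gen E B hB 0 r h = ιB r := by
  ext
  simp [gen, hιB, tpow]

include hc hιB htf hB hm0 in
theorem ann_iff [IsSimpleModule ↥B W] {α : Fin n → ℤ} {v : W}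
    (hv : v ∈ weightSpace ιB W (orb σ m0 α)) (hv0 : v ≠ 0) (b : ↥B) :
    b • v = 0 ↔ ∀ c : ↥B, coef E 0 ((c * b : ↥B) : A) ∈ orb σ m0 α := by
  have hmax := orb_maximal σ m0 hm0 α
  have key : ∀ b : ↥B, b • v ∈ weightSpace ιB W (orb σ m0 α) →
      b • v = ιB (coef E 0 (b : A)) • v := by
    intro b hb
    obtain ⟨h, e⟩ := exists_gen E B hB hc ιB hιB m0 hm0 htf hv b (γ := 0)
      (by rw [zero_add]; exact hb)
    rwa [gen_zero_eq E B hB ιB hιB] at e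
  constructor
  · intro h c
    have h1 : (c * b) • v = 0 := by rw [mul_smul, h, smul_zero]
    have h2 := key (c * b) (by rw [h1]; exact zero_mem _)
    rw [h1] at h2
    exact (smul_eq_zero_iff' ιB hmax hv hv0 _).1 h2.symm
  · intro h
    by_contra hb
    obtain ⟨c, hcw⟩ := IsSimpleModule.toSpanSingleton_surjective ↥B hb v
    rw [LinearMap.toSpanSingleton_apply, smul_smul] at hcw
    have h2 := key (c * b) (by rw [hcw]; exact hv)
    rw [hcw, hv _ (h c)] at h2
    exact hv0 h2

include hc hιB htf hB hm0 in
theorem iso_of_common {W' : Type*} [AddCommGroup W'] [Module ↥B W']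
    [IsSimpleModule ↥B W] [IsSimpleModule ↥B W'] {α : Fin n → ℤ} {v : W} {v' : W'}
    (hv : v ∈ weightSpace ιB W (orb σ m0 α)) (hv0 : v ≠ 0)
    (hv' : v' ∈ weightSpace ιB W' (orb σ m0 α)) (hv0' : v' ≠ 0) :
    Nonempty (W ≃ₗ[↥B] W') := by
  have hker : LinearMap.ker (LinearMap.toSpanSingleton ↥B W v) =
      LinearMap.ker (LinearMap.toSpanSingleton ↥B W' v') := by
    ext b
    rw [LinearMap.mem_ker, LinearMap.mem_ker, LinearMap.toSpanSingleton_apply,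
      LinearMap.toSpanSingleton_apply, ann_iff E B hB hc ιB hιB m0 hm0 htf hv hv0,
      ann_iff E B hB hc ιB hιB m0 hm0 htf hv' hv0']
  exact ⟨((LinearMap.quotKerEquivOfSurjective _
      (IsSimpleModule.toSpanSingleton_surjective ↥B hv0)).symm.trans
    (Submodule.quotEquivOfEq _ _ hker)).trans (LinearMap.quotKerEquivOfSurjective _
      (IsSimpleModule.toSpanSingleton_surjective ↥B hv0'))⟩

include hc hB hιB hm0 in
theorem gen_weight {α : Fin n → ℤ} {v : W} (hv : v ∈ weightSpace ιB W (orb σ m0 α))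
    (hgen : ∀ w : W, ∃ b : ↥B, b • v = w) :
    (⨆ m : MaximalSpectrum R, weightSpace ιB W m.asIdeal) = ⊤ := by
  rw [eq_top_iff]
  rintro w -
  obtain ⟨b, rfl⟩ := hgen w
  induction b using gen_induction E B hB with
  | h0 => rw [zero_smul]; exact zero_mem _
  | ha x y hx hy => rw [add_smul]; exact add_mem hx hy
  | hg γ r h =>
    exact (le_iSup (fun m : MaximalSpectrum R => weightSpace ιB W m.asIdeal)
      (orbM σ m0 hm0 (γ + α))) (gen_smul_mem E B hB hc ιB hιB m0 hv γ r h)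

include hc hB hιB hm0 in
theorem gen_supp {α : Fin n → ℤ} {v : W} (hv : v ∈ weightSpace ιB W (orb σ m0 α))
    (hgen : ∀ w : W, ∃ b : ↥B, b • v = w) (m : MaximalSpectrum R)
    (hm : weightSpace ιB W m.asIdeal ≠ ⊥) : ∃ β, m.asIdeal = orb σ m0 β := by
  by_contra! hcon
  obtain ⟨w, hw, hw0⟩ := (AddSubgroup.bot_or_exists_ne_zero _).resolve_left hm
  apply hw0
  apply eq_zero_of_oth ιB hw
  obtain ⟨b, rfl⟩ := hgen w
  clear hw hw0
  induction b using gen_induction E B hB with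
  | h0 => rw [zero_smul]; exact zero_mem _
  | ha x y hx hy => rw [add_smul]; exact add_mem hx hy
  | hg γ r h =>
    refine mem_oth ιB (m' := orbM σ m0 hm0 (γ + α)) ?_
        (gen_smul_mem E B hB hc ιB hιB m0 hv γ r h)
    rintro rfl
    exact hcon _ rfl

theorem coef_zero_mul (a : A) (r : R) : coef E 0 (a * E.ι r) = coef E 0 a * r := by
  obtain ⟨c, rfl⟩ := E.repr_exists a
  induction c using Finsupp.induction_linear with
  | zero => simp
  | add f g hf hg =>
    rw [← sumHom_apply] at *
    rw [map_add, add_mul, map_add, map_add, hf, hg, add_mul]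
  | single δ s =>
    rw [Finsupp.sum_single_index (by simp), mul_assoc, tpow_comm, ← mul_assoc, ← map_mul,
      coef_mono, coef_mono]
    by_cases hδ : δ = 0
    · subst hδ
      simp [σpow_zero]
    · rw [Finsupp.single_eq_of_ne (Ne.symm hδ), Finsupp.single_eq_of_ne (Ne.symm hδ), zero_mul]

include hιB in
theorem exists_max (m : Ideal R) (hm : m ≠ ⊤) :
    ∃ L : Submodule ↥B ↥B, IsCoatom L ∧ ∀ r ∈ m, ιB r ∈ L := by
  have hne : Ideal.span (ιB '' (m : Set R)) ≠ ⊤ := by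
    intro htop
    have h1 : (1 : ↥B) ∈ Ideal.span (ιB '' (m : Set R)) := htop ▸ Submodule.mem_top
    have h2 : ∀ b ∈ Ideal.span (ιB '' (m : Set R)), ∀ a : ↥B, coef E 0 ((a * b : ↥B) : A) ∈ m := by
      intro b hb
      induction hb using Submodule.span_induction with
      | mem x hx =>
        obtain ⟨r, hr, rfl⟩ := hx
        intro a
        rw [MulMemClass.coe_mul, hιB, coef_zero_mul]
        exact m.mul_mem_left _ hr
      | zero => simp
      | add x y _ _ hx hy =>
        intro a
        rw [mul_add, AddMemClass.coe_add, map_add]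
        exact add_mem (hx a) (hy a)
      | smul c x hx' hx =>
        intro a
        rw [smul_eq_mul, ← mul_assoc]
        exact hx _
    have h3 := h2 1 h1 1
    rw [one_mul] at h3
    have h4 : coef E 0 (1 : A) = 1 := by
      have := coef_mono E 0 0 1
      simpa [tpow] using this
    apply hm
    rw [Ideal.eq_top_iff_one, ← h4]
    exact h3
  obtain ⟨L, hL, hle⟩ := Ideal.exists_le_maximal _ hne
  exact ⟨L, hL.out, fun r hr => hle (Ideal.subset_span ⟨r, hr, rfl⟩)⟩

end alg

theorem supp_nonempty {k R B : Type*} [Field k] [CommRing R] [Algebra k R]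
    [Ring B] [Algebra k B] {ιB : R →ₐ[k] B} (W : SimpleWeightWitness k B ιB) :
    ∃ m, m ∈ W.supp := by
  by_contra! h
  have h1 : ∀ m : MaximalSpectrum R, weightSpace ιB W.M m.asIdeal = ⊥ :=
    fun m => not_not.1 (h m)
  have h2 := W.weight.1
  simp only [h1, iSup_bot] at h2
  have := W.simple
  have := IsSimpleModule.nontrivial B W.M
  exact bot_ne_top h2

end Aux

/-- Classification of simple weight modules supported on a
torsion-free orbit.  Identifying the orbit `O = ℤⁿ ⬝ 𝔪₀` with `ℤⁿ`, the `i`-breaks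
form a `Γᵢ`-stable set determined by the set `breakSet i ⊆ ℤ` of `i`-th
coordinates; an element of the extended break set `β̄ᵢ'` is either an actual break
(`some b` with `b ∈ breakSet i`) or `∞ᵢ` (`none`, allowed precisely when
`breakSet i` is empty or has a maximal element, i.e. is bounded above).  The
isomorphism classes of simple weight modules supported on `O` are in bijection
with the tuples in `∏ᵢ β̄ᵢ'`; the module corresponding to a tuple has support the
"box" cut out between consecutive break hyperplanes. -/
theorem brAlgebra_simple_weight_classification
    {k : Type uk} {R : Type uR} {A : Type uA}
    [Field k] [CommRing R] [Algebra k R] [Ring A] [Algebra k A]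
    {n : ℕ} {σ : Fin n → R ≃ₐ[k] R} {p : Fin n → Fin n → kˣ}
    {H J : Fin n → Submodule k R} (hD : IsBRDatum σ p H J)
    (E : SkewLaurent k σ p A) (B : Subalgebra k A)
    (hB : Subalgebra.toSubmodule B = brSubmodule E H J)
    (ιB : R →ₐ[k] ↥B) (hιB : ∀ r : R, ((ιB r : ↥B) : A) = E.ι r)
    -- a torsion-free orbit `O = ℤⁿ ⬝ 𝔪₀`
    (m0 : Ideal R) (hm0 : m0.IsMaximal)
    (htf : ∀ α : Fin n → ℤ, Ideal.map (σpow σ α) m0 = m0 → α = 0)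
    -- the set of `i`-th coordinates of `i`-breaks:  `σᵢ^c(𝔪₀)` is an `i`-break
    -- iff `Hᵢ Jᵢ ⊆ σᵢ^{c+1}(𝔪₀)`
    (breakSet : Fin n → Set ℤ)
    (hbreakSet : ∀ (i : Fin n) (c : ℤ), c ∈ breakSet i ↔
      (H i * J i : Submodule k R) ≤ Submodule.restrictScalars k
        (Ideal.map (σpow σ (Pi.single i (c + 1))) m0))
    -- validity of a tuple in `∏ᵢ β̄ᵢ'`, and membership in the corresponding box
    (Valid : (Fin n → Option ℤ) → Prop)
    (hValid : ∀ η, Valid η ↔ ∀ i : Fin n,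
      (∀ c : ℤ, η i = some c → c ∈ breakSet i) ∧
      (η i = none → BddAbove (breakSet i)))
    (boxMem : (Fin n → Option ℤ) → (Fin n → ℤ) → Prop)
    (hboxMem : ∀ η α, boxMem η α ↔ ∀ i : Fin n,
      (η i).elim (∀ c ∈ breakSet i, c < α i)
        (fun c => α i ≤ c ∧ ∀ c' ∈ breakSet i, ¬(α i ≤ c' ∧ c' < c))) :
    -- two simple weight modules supported on `O` are isomorphic iff they have the
    -- same support
    (∀ (W : SimpleWeightWitness k ↥B ιB) (W' : SimpleWeightWitness k ↥B ιB),
      W.supp ⊆ {m' | ∃ α : Fin n → ℤ, m'.asIdeal = Ideal.map (σpow σ α) m0} →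
      W'.supp ⊆ {m' | ∃ α : Fin n → ℤ, m'.asIdeal = Ideal.map (σpow σ α) m0} →
      (W.Iso W' ↔ W.supp = W'.supp)) ∧
    -- every valid tuple of breaks is realized by a simple weight module whose
    -- support is the corresponding box
    (∀ η : Fin n → Option ℤ, Valid η →
      ∃ W : SimpleWeightWitness.{max uR uA, uk, uR, uA} k ↥B ιB,
        W.supp = {m' | ∃ α : Fin n → ℤ, boxMem η α ∧
          m'.asIdeal = Ideal.map (σpow σ α) m0}) ∧
    -- conversely, the support of any simple weight module supported on `O` is the
    -- box of a unique valid tuple of breaks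
    (∀ W : SimpleWeightWitness k ↥B ιB,
      W.supp ⊆ {m' | ∃ α : Fin n → ℤ, m'.asIdeal = Ideal.map (σpow σ α) m0} →
      ∃! η : Fin n → Option ℤ, Valid η ∧
        W.supp = {m' | ∃ α : Fin n → ℤ, boxMem η α ∧
          m'.asIdeal = Ideal.map (σpow σ α) m0}) := by
  have hc := hD.comm
  have hVal : ∀ η, Valid η ↔ ∀ i, valid1 (breakSet i) (η i) := hValid
  have hBox : ∀ η α, boxMem η α ↔ ∀ i, box1 (breakSet i) (η i) (α i) := hboxMem
  have hconn := conn_iff hD hm0 breakSet hbreakSet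
  have hinj : ∀ {α β : Fin n → ℤ}, orb σ m0 α = orb σ m0 β → α = β :=
    fun e => orb_inj hc m0 htf e
  -- boxes and connectedness
  have hboxconn : ∀ η α, Valid η → boxMem η α → ∀ β, boxMem η β ↔ Conn σ H J m0 α β := by
    intro η α hv hb β
    rw [hconn, hBox]
    exact forall_congr' fun i => box1_iff ((hVal η).1 hv i) ((hBox η α).1 hb i) (β i)
  have hboxuniq : ∀ η η' α, Valid η → Valid η' → boxMem η α → boxMem η' α → η = η' := by
    intro η η' α hv hv' hb hb'
    funext i
    exact box1_unique ((hVal η).1 hv i) ((hVal η').1 hv' i) ((hBox η α).1 hb i)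
      ((hBox η' α).1 hb' i)
  refine ⟨?_, ?_, ?_⟩
  · intro W W' hW hW'
    have := W.simple
    have := W'.simple
    constructor
    · rintro ⟨e⟩
      ext m
      have key : ∀ (v : W.M), v ∈ weightSpace ιB W.M m.asIdeal ↔
          e v ∈ weightSpace ιB W'.M m.asIdeal := by
        intro v
        refine forall₂_congr fun r _ => ?_
        rw [← map_smul, LinearEquiv.map_eq_zero_iff]
      change weightSpace ιB W.M m.asIdeal ≠ ⊥ ↔ weightSpace ιB W'.M m.asIdeal ≠ ⊥
      rw [not_iff_not, AddSubgroup.eq_bot_iff_forall, AddSubgroup.eq_bot_iff_forall]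
      constructor
      · intro h w hw
        have h1 := h (e.symm w) ((key _).2 (by rwa [LinearEquiv.apply_symm_apply]))
        simpa using h1
      · intro h v hv
        simpa using h (e v) ((key v).1 hv)
    · intro hs
      obtain ⟨m, hm⟩ := supp_nonempty W
      obtain ⟨α, hα⟩ := hW hm
      obtain ⟨v, hv, hv0⟩ := (AddSubgroup.bot_or_exists_ne_zero _).resolve_left hm
      have hm' := hm
      rw [hs] at hm'
      obtain ⟨v', hv', hv0'⟩ := (AddSubgroup.bot_or_exists_ne_zero _).resolve_left hm'
      rw [hα] at hv hv'
      exact iso_of_common E B hB hc ιB hιB m0 hm0 htf (α := α) hv hv0 hv' hv0'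
  · intro η hη
    choose α hα using fun i => box1_nonempty ((hVal η).1 hη i)
    have hbα : boxMem η α := (hBox η α).2 hα
    obtain ⟨L, hL, hle⟩ := exists_max E B ιB hιB (orb σ m0 α) (orb_maximal σ m0 hm0 α).ne_top
    have hs : IsSimpleModule ↥B (↥B ⧸ L) := isSimpleModule_iff_isCoatom.2 hL
    have hs' : IsSimpleModule ↥B (ULift.{uR} (↥B ⧸ L)) :=
      IsSimpleModule.congr ULift.moduleEquiv
    let v : ULift.{uR} (↥B ⧸ L) := ULift.up (Submodule.Quotient.mk 1)
    have hsm : ∀ b : ↥B, b • v = ULift.up (Submodule.Quotient.mk b) := by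
      intro b
      change ULift.up (Submodule.Quotient.mk (b • (1 : ↥B))) = _
      rw [smul_eq_mul, mul_one]
    have hv : v ∈ weightSpace ιB (ULift.{uR} (↥B ⧸ L)) (orb σ m0 α) := by
      intro r hr
      rw [hsm, (Submodule.Quotient.mk_eq_zero L).2 (hle r hr)]
      rfl
    have hgen : ∀ w : ULift.{uR} (↥B ⧸ L), ∃ b : ↥B, b • v = w := by
      rintro ⟨w⟩
      obtain ⟨b, rfl⟩ := Submodule.Quotient.mk_surjective _ w
      exact ⟨b, hsm b⟩
    have hv0 : v ≠ 0 := by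
      intro h0
      have := IsSimpleModule.nontrivial ↥B (ULift.{uR} (↥B ⧸ L))
      obtain ⟨x, hx⟩ := exists_ne (0 : ULift.{uR} (↥B ⧸ L))
      obtain ⟨b, hb⟩ := hgen x
      rw [h0, smul_zero] at hb
      exact hx hb.symm
    refine ⟨{ M := ULift.{uR} (↥B ⧸ L), simple := hs',
              weight := ⟨gen_weight E B hB hc ιB hιB m0 hm0 hv hgen, weight_indep ιB⟩ }, ?_⟩
    ext m
    change weightSpace ιB (ULift.{uR} (↥B ⧸ L)) m.asIdeal ≠ ⊥ ↔
      ∃ β, boxMem η β ∧ m.asIdeal = orb σ m0 β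
    constructor
    · intro hm
      obtain ⟨β, hβ⟩ := gen_supp E B hB hc ιB hιB m0 hm0 hv hgen m hm
      refine ⟨β, ?_, hβ⟩
      rw [hboxconn η α hη hbα]
      rw [hβ] at hm
      exact (conn_iff_mem E B hB hc ιB hιB m0 hm0 htf hv hv0 β).1 hm
    · rintro ⟨β, hb, hβ⟩
      rw [hβ]
      rw [hboxconn η α hη hbα] at hb
      exact (conn_iff_mem E B hB hc ιB hιB m0 hm0 htf hv hv0 β).2 hb
  · intro W hW
    have := W.simple
    obtain ⟨m, hm⟩ := supp_nonempty W
    obtain ⟨α, hα⟩ := hW hm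
    obtain ⟨v, hv, hv0⟩ := (AddSubgroup.bot_or_exists_ne_zero _).resolve_left hm
    rw [hα] at hv
    choose η hη1 hη2 using fun i => box1_exists (breakSet i) (α i)
    have hη : Valid η := (hVal η).2 hη1
    have hbα : boxMem η α := (hBox η α).2 hη2
    refine ⟨η, ⟨hη, ?_⟩, ?_⟩
    · ext m'
      change weightSpace ιB W.M m'.asIdeal ≠ ⊥ ↔
        ∃ β, boxMem η β ∧ m'.asIdeal = orb σ m0 β
      constructor
      · intro hm'
        obtain ⟨β, hβ⟩ := hW hm'
        refine ⟨β, ?_, hβ⟩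
        rw [hboxconn η α hη hbα]
        rw [hβ] at hm'
        exact (conn_iff_mem E B hB hc ιB hιB m0 hm0 htf hv hv0 β).1 hm'
      · rintro ⟨β, hb, hβ⟩
        rw [hβ]
        rw [hboxconn η α hη hbα] at hb
        exact (conn_iff_mem E B hB hc ιB hιB m0 hm0 htf hv hv0 β).2 hb
    · rintro η' ⟨hη', hs⟩
      rw [hs] at hm
      obtain ⟨β, hb, hβ⟩ := hm
      have e : α = β := hinj (hα.symm.trans hβ)
      subst e
      exact hboxuniq η' η α hη' hη hb hbα

end BR
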